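/- Let F = F(A) be a free group of finite rank at least 2 with basis A. There exists a constant N (depending only on F) with the following property: for every orientable quadratic word Q over F, if the equation Q = 1 has a solution in F, then it has a solution φ such that for every variable x, the word length |φ(x)| with respect to A satisfies |φ(x)| ≤ N·|Q|⁴, where |Q| denotes the length of Q as a reduced word in the free group on A together with the variables. -/

import Mathlib

namespace Stmt7

/-- Word length of an element of the free group F(A) w.r.t. the basis A: the length of
its reduced word. -/
def len {r : ℕ} (g : FreeGroup (Fin r)) : ℕ := g.toWord.length

/-- Number of occurrences of the variable x (as x or x⁻¹) in the reduced word Q. -/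
def occ {r nv : ℕ} (Q : FreeGroup (Fin nv ⊕ Fin r)) (x : Fin nv) : ℕ :=
  (Q.toWord.filter fun l => decide (l.1 = Sum.inl x)).length

/-- Number of occurrences of the variable x with the given sign in the reduced word Q. -/
def occS {r nv : ℕ} (Q : FreeGroup (Fin nv ⊕ Fin r)) (x : Fin nv) (s : Bool) : ℕ :=
  (Q.toWord.filter fun l => decide (l.1 = Sum.inl x) && (l.2 == s)).length

/-- A solution of the equation Q = 1 in F = F(A): a homomorphism F(X ∪ A) → F
sending each a ∈ A to itself and killing Q. -/
def IsSol {r nv : ℕ} (Q : FreeGroup (Fin nv ⊕ Fin r))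
    (φ : FreeGroup (Fin nv ⊕ Fin r) →* FreeGroup (Fin r)) : Prop :=
  (∀ a : Fin r, φ (FreeGroup.of (Sum.inr a)) = FreeGroup.of a) ∧ φ Q = 1

end Stmt7

namespace QEq

variable {α : Type} {G : Type} [Group G] {K : Type} [Group K]

/-- inverse letter -/
def iv (l : α × Bool) : α × Bool := (l.1, !l.2)

/-- value of a letter -/
def lv (f : α → G) (l : α × Bool) : G := if l.2 then f l.1 else (f l.1)⁻¹

/-- value of a word -/
def ev (f : α → G) (w : List (α × Bool)) : G := (w.map (lv f)).prod

@[simp] lemma iv_fst (l : α × Bool) : (iv l).1 = l.1 := rfl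
@[simp] lemma iv_iv (l : α × Bool) : iv (iv l) = l := by simp [iv]
lemma iv_ne (l : α × Bool) : iv l ≠ l := by
  rcases l with ⟨a, b⟩; cases b <;> simp [iv]

@[simp] lemma lv_iv (f : α → G) (l : α × Bool) : lv f (iv l) = (lv f l)⁻¹ := by
  rcases l with ⟨a, b⟩; cases b <;> simp [iv, lv]

@[simp] lemma ev_nil (f : α → G) : ev f [] = 1 := rfl
@[simp] lemma ev_cons (f : α → G) (l) (w) : ev f (l :: w) = lv f l * ev f w := by simp [ev]
@[simp] lemma ev_append (f : α → G) (u w) : ev f (u ++ w) = ev f u * ev f w := by simp [ev]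

lemma lv_congr {f g : α → G} {l : α × Bool} (h : f l.1 = g l.1) : lv f l = lv g l := by
  simp [lv, h]

lemma ev_congr {f g : α → G} {w : List (α × Bool)} (h : ∀ l ∈ w, f l.1 = g l.1) :
    ev f w = ev g w := by
  unfold ev
  congr 1
  apply List.map_congr_left
  intro l hl
  exact lv_congr (h l hl)

lemma map_lv (φ : G →* K) (f : α → G) (l) : φ (lv f l) = lv (fun a => φ (f a)) l := by
  unfold lv; split <;> simp

lemma map_ev (φ : G →* K) (f : α → G) (w) : φ (ev f w) = ev (fun a => φ (f a)) w := by
  induction w with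
  | nil => simp
  | cons l w ih => simp [ih, map_lv]

lemma ev_of (w : List (α × Bool)) : ev FreeGroup.of w = FreeGroup.mk w := by
  induction w with
  | nil => rfl
  | cons l w ih =>
    rw [ev_cons, ih]
    rcases l with ⟨a, b⟩
    cases b <;> simp [lv, FreeGroup.of, FreeGroup.invRev]

lemma ev_map {β : Type} (f : β → G) (μ : α → β) (w : List (α × Bool)) :
    ev f (w.map (fun l => (μ l.1, l.2))) = ev (fun a => f (μ a)) w := by
  induction w with
  | nil => rfl
  | cons l w ih => simp [ih, lv]

section bal
variable [DecidableEq α]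

/-- each letter occurs at most once with each sign, and equally often with both -/
def Bal (P : α → Prop) (w : List (α × Bool)) : Prop :=
  ∀ a, P a → w.count (a, true) = w.count (a, false) ∧ w.count (a, true) ≤ 1

lemma Bal.count {P : α → Prop} {w : List (α × Bool)} (h : Bal P w) {l : α × Bool} (hl : P l.1) :
    w.count l = w.count (iv l) ∧ w.count l ≤ 1 := by
  rcases l with ⟨a, b⟩
  have := h a hl
  cases b <;> simp [iv] <;> omega

lemma Bal.perm {P : α → Prop} {w w' : List (α × Bool)} (h : Bal P w) (hp : w.Perm w') :
    Bal P w' := by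
  intro a ha
  have := h a ha
  rwa [hp.count_eq, hp.count_eq] at this

lemma Bal.tail {P : α → Prop} {p : α × Bool} {w : List (α × Bool)} (h : Bal P (p :: iv p :: w)) :
    Bal P w := by
  intro a ha
  have := h a ha
  rcases p with ⟨c, b⟩
  by_cases hc : c = a
  · subst hc
    cases b <;> simp [iv] at this ⊢ <;> omega
  · simpa [iv, List.count_cons, hc] using this

lemma Bal.notin {P : α → Prop} {p : α × Bool} (hp : P p.1) {w : List (α × Bool)}
    (h : Bal P (p :: iv p :: w)) : ∀ l ∈ w, l.1 ≠ p.1 := by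
  intro l hl hlp
  have h1 := h p.1 hp
  have h2 : 0 < w.count l := List.count_pos_iff.2 hl
  rcases p with ⟨c, b⟩
  rcases l with ⟨c', b'⟩
  simp only at hlp
  subst hlp
  cases b <;> cases b' <;> simp [iv] at h1 <;> omega

lemma chord_aux {P : α → Prop} {w : List (α × Bool)} (h : Bal P w) : ∀ n : ℕ, ∀ u p m z,
    m.length ≤ n → w = u ++ p :: (m ++ iv p :: z) → P p.1 →
    (∃ u p m z, w = u ++ p :: (m ++ iv p :: z) ∧ P p.1 ∧ ∀ l ∈ m, ¬ P l.1) ∨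
    (∃ u p v q s t r, w = u ++ p :: (v ++ q :: (s ++ iv p :: (t ++ iv q :: r))) ∧
      P p.1 ∧ P q.1) := by
  intro n
  induction n with
  | zero =>
    intro u p m z hm hw hp
    left
    refine ⟨u, p, m, z, hw, hp, ?_⟩
    have : m = [] := List.length_eq_zero_iff.1 (by omega)
    simp [this]
  | succ n ih =>
    intro u p m z hm hw hp
    by_cases hP : ∀ l ∈ m, ¬ P l.1
    · exact Or.inl ⟨u, p, m, z, hw, hp, hP⟩
    push Not at hP
    obtain ⟨q, hq, hPq⟩ := hP
    obtain ⟨m1, m2, rfl⟩ := List.append_of_mem hq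
    have hqw : q ∈ w := by rw [hw]; simp
    have hc := h.count hPq
    have hmem : iv q ∈ w := by
      rw [← List.count_pos_iff, ← hc.1, List.count_pos_iff]; exact hqw
    have hcp := (h.count hp).2
    have hcp' := (h.count (l := iv p) hp).2
    have hcq := hc.2
    rw [hw] at hmem
    simp only [List.mem_append, List.mem_cons] at hmem
    rcases hmem with hmem | hmem | (hmem | hmem | hmem) | hmem | hmem
    · obtain ⟨u1, u2, rfl⟩ := List.append_of_mem hmem
      right
      exact ⟨u1, iv q, u2, p, m1, m2, z, by rw [hw]; simp, hPq, hp⟩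
    · exfalso
      subst hmem
      rw [hw] at hcp'
      simp [List.count_cons] at hcp'
      omega
    · obtain ⟨a, b, rfl⟩ := List.append_of_mem hmem
      refine ih (u ++ p :: a) (iv q) b (m2 ++ iv p :: z) ?_ ?_ hPq
      · simp at hm; omega
      · rw [hw]; simp
    · exact absurd hmem (iv_ne q)
    · obtain ⟨a, b, rfl⟩ := List.append_of_mem hmem
      refine ih (u ++ p :: m1) q a (b ++ iv p :: z) ?_ ?_ hPq
      · simp at hm; omega
      · rw [hw]; simp
    · exfalso
      have : q = p := by rw [← iv_iv q, hmem, iv_iv]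
      subst this
      rw [hw] at hcp
      simp at hcp
      omega
    · obtain ⟨u1, u2, rfl⟩ := List.append_of_mem hmem
      right
      exact ⟨u, p, m1, q, m2, u1, u2, by rw [hw]; simp, hp, hPq⟩

lemma Bal.split {P : α → Prop} {w : List (α × Bool)} (h : Bal P w) {l : α × Bool} (hl : l ∈ w)
    (hP : P l.1) : ∃ u p m z, w = u ++ p :: (m ++ iv p :: z) ∧ p.1 = l.1 := by
  have hc := h.count hP
  have hmem : iv l ∈ w := by
    rw [← List.count_pos_iff, ← hc.1, List.count_pos_iff]; exact hl
  obtain ⟨a, b, rfl⟩ := List.append_of_mem hl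
  simp only [List.mem_append, List.mem_cons] at hmem
  rcases hmem with hmem | hmem | hmem
  · obtain ⟨u1, u2, rfl⟩ := List.append_of_mem hmem
    exact ⟨u1, iv l, u2, b, by simp, rfl⟩
  · exact absurd hmem (iv_ne l)
  · obtain ⟨u1, u2, rfl⟩ := List.append_of_mem hmem
    exact ⟨a, l, u1, u2, by simp, rfl⟩

lemma chord {P : α → Prop} {w : List (α × Bool)} (h : Bal P w) :
    (∀ l ∈ w, ¬ P l.1) ∨
    (∃ u p m z, w = u ++ p :: (m ++ iv p :: z) ∧ P p.1 ∧ ∀ l ∈ m, ¬ P l.1) ∨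
    (∃ u p v q s t r, w = u ++ p :: (v ++ q :: (s ++ iv p :: (t ++ iv q :: r))) ∧
      P p.1 ∧ P q.1) := by
  by_cases h0 : ∀ l ∈ w, ¬ P l.1
  · exact Or.inl h0
  right
  push Not at h0
  obtain ⟨l, hl, hP⟩ := h0
  obtain ⟨u, p, m, z, hw, hp⟩ := h.split hl hP
  exact chord_aux h m.length u p m z le_rfl hw (hp ▸ hP)

end bal

/-! ### Heisenberg type group -/

/-- class two nilpotent group -/
@[ext] structure Heis (α : Type) where
  v : α → ℚ
  m : α → α → ℚ

namespace Heis

instance : Mul (Heis α) := ⟨fun x y => ⟨x.v + y.v, fun i j => x.m i j + y.m i j + x.v i * y.v j⟩⟩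
instance : One (Heis α) := ⟨⟨0, fun _ _ => 0⟩⟩
instance : Inv (Heis α) := ⟨fun x => ⟨-x.v, fun i j => - x.m i j + x.v i * x.v j⟩⟩

@[simp] lemma mul_v (x y : Heis α) : (x * y).v = x.v + y.v := rfl
@[simp] lemma mul_m (x y : Heis α) (i j) : (x * y).m i j = x.m i j + y.m i j + x.v i * y.v j := rfl
@[simp] lemma one_v : (1 : Heis α).v = 0 := rfl
@[simp] lemma one_m (i j) : (1 : Heis α).m i j = 0 := rfl
@[simp] lemma inv_v (x : Heis α) : (x⁻¹).v = - x.v := rfl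
@[simp] lemma inv_m (x : Heis α) (i j) : (x⁻¹).m i j = - x.m i j + x.v i * x.v j := rfl

instance : Group (Heis α) := Group.ofLeftAxioms
  (by intro a b c; ext i j <;> simp <;> ring)
  (by intro a; ext i j <;> simp)
  (by intro a; ext i j <;> simp)

lemma central {z : Heis α} (hz : z.v = 0) (x : Heis α) : z * x = x * z := by
  ext i j <;> simp [hz]; ring

/-- wedge of two vectors -/
def wedge (a b : α → ℚ) : α → α → ℚ := fun i j => a i * b j - b i * a j

lemma comm_eq (x y : Heis α) : x * y * x⁻¹ * y⁻¹ = ⟨0, wedge x.v y.v⟩ := by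
  ext i j
  · simp
  · simp [wedge]; ring

/-- generator -/
def e [DecidableEq α] (c : α) : Heis α := ⟨Pi.single c 1, 0⟩

/-- the projection killing q (where q c = 1) -/
def prj (c : α) (q : α → ℚ) : Heis α →* Heis α where
  toFun x := ⟨fun i => x.v i - x.v c * q i,
    fun i j => x.m i j - q i * x.m c j - x.m i c * q j + q i * x.m c c * q j⟩
  map_one' := by ext i j <;> simp
  map_mul' x y := by ext i j <;> simp <;> ring

lemma prj_v (c : α) (q : α → ℚ) (x : Heis α) (i) : (prj c q x).v i = x.v i - x.v c * q i := rfl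
lemma prj_m (c : α) (q : α → ℚ) (x : Heis α) (i j) : (prj c q x).m i j =
  x.m i j - q i * x.m c j - x.m i c * q j + q i * x.m c c * q j := rfl

lemma prj_e [DecidableEq α] {c : α} (q : α → ℚ) {a : α} (h : a ≠ c) : prj c q (e a) = e a := by
  ext i j
  · simp [prj_v, e, Pi.single_apply, h.symm]
  · simp [prj_m, e]

/-- sum of wedges -/
def wsum (l : List ((α → ℚ) × (α → ℚ))) : α → α → ℚ := fun i j => (l.map (fun p => wedge p.1 p.2 i j)).sum

@[simp] lemma wsum_nil : wsum ([] : List ((α → ℚ) × (α → ℚ))) = fun _ _ => 0 := rfl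
lemma wsum_cons (p) (l : List ((α → ℚ) × (α → ℚ))) (i j) :
  wsum (p :: l) i j = wedge p.1 p.2 i j + wsum l i j := by simp [wsum]

/-- central elements that are products of `k` commutators -/
def HT (k : ℕ) (x : Heis α) : Prop := x.v = 0 ∧ ∃ l, l.length = k ∧ x.m = wsum l

lemma HT.prj {k : ℕ} {x : Heis α} (h : HT k x) (c : α) (q : α → ℚ) : HT k (prj c q x) := by
  obtain ⟨h0, l, hl, hm⟩ := h
  refine ⟨?_, l.map (fun p => (fun i => p.1 i - p.1 c * q i, fun i => p.2 i - p.2 c * q i)), by simpa using hl, ?_⟩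
  · ext i; simp [prj_v, h0]
  · ext i j
    rw [prj_m, hm]
    clear hm hl
    induction l with
    | nil => simp
    | cons p l ih =>
      simp only [wsum_cons, List.map_cons] at ih ⊢
      rw [← ih]
      simp only [wedge]; ring

/-- elimination: a vanishing combination lets us drop one wedge -/
lemma drop_wedge : ∀ (l : List (((α → ℚ) × (α → ℚ)) × (ℚ × ℚ))),
    (∃ x ∈ l, x.2 ≠ 0) →
    (∀ i, (l.map (fun x => x.2.1 * x.1.1 i + x.2.2 * x.1.2 i)).sum = 0) →
    ∃ l', l'.length + 1 = l.length ∧ wsum l' = wsum (l.map Prod.fst) := by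
  -- key step for the head
  have key : ∀ (a b : α → ℚ) (s t : ℚ), s ≠ 0 →
      ∀ (l : List (((α → ℚ) × (α → ℚ)) × (ℚ × ℚ))),
      (∀ i, s * a i + t * b i + (l.map (fun x => x.2.1 * x.1.1 i + x.2.2 * x.1.2 i)).sum = 0) →
      ∃ l', l'.length = l.length ∧ ∀ i j, wsum l' i j = wedge a b i j + wsum (l.map Prod.fst) i j := by
    intro a b s t hs l h
    refine ⟨l.map (fun x => (fun i => x.1.1 i + (x.2.2 / s) * b i, fun i => x.1.2 i - (x.2.1 / s) * b i)),
      by simp, ?_⟩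
    intro i j
    have ha : ∀ i, a i = - (t / s) * b i - (1/s) * (l.map (fun x => x.2.1 * x.1.1 i + x.2.2 * x.1.2 i)).sum := by
      intro i
      have := h i
      field_simp
      linarith
    have hw : wedge a b i j = - (1/s) * ((l.map (fun x => x.2.1 * x.1.1 i + x.2.2 * x.1.2 i)).sum * b j
      - (l.map (fun x => x.2.1 * x.1.1 j + x.2.2 * x.1.2 j)).sum * b i) := by
      rw [wedge, ha i, ha j]; ring
    rw [hw]
    clear hw ha h
    induction l with
    | nil => simp
    | cons x l ih =>
      simp only [List.map_cons, wsum_cons, List.sum_cons] at ih ⊢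
      rw [ih]
      simp only [wedge]
      ring
  intro l hx hl
  obtain ⟨x, hx, hne⟩ := hx
  obtain ⟨l1, l2, rfl⟩ := List.append_of_mem hx
  obtain ⟨⟨a, b⟩, ⟨s, t⟩⟩ := x
  have hw : ∀ i j, wsum ((l1 ++ ((a, b), (s, t)) :: l2).map Prod.fst) i j
      = wedge a b i j + wsum ((l1 ++ l2).map Prod.fst) i j := by
    intro i j; simp [wsum]; ring
  by_cases hs : s = 0
  · have ht : t ≠ 0 := by
      rintro rfl; exact hne (by simp [hs])
    obtain ⟨l', h1, h2⟩ := key b (fun i => - a i) t (-s) ht (l1 ++ l2) (by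
      intro i; have := hl i; simp at this ⊢; linarith)
    refine ⟨l', by simp at h1 ⊢; omega, ?_⟩
    ext i j
    rw [h2, hw]; simp [wedge]; ring
  · obtain ⟨l', h1, h2⟩ := key a b s t hs (l1 ++ l2) (by
      intro i; have := hl i; simp at this ⊢; linarith)
    refine ⟨l', by simp at h1 ⊢; omega, ?_⟩
    ext i j
    rw [h2, hw]

lemma reduce_wedge {P Q : α → ℚ} {A : α → α → ℚ} {c d : α} (hPc : P c ≠ 0) (hPd : P d = 0)
    (hQd : Q d ≠ 0) (hA1 : ∀ i, A c i = 0) (hA2 : ∀ i, A i c = 0)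
    (hA4 : ∀ i, A i d = 0)
    (l : List ((α → ℚ) × (α → ℚ))) (h : ∀ i j, A i j + wedge P Q i j = wsum l i j) :
    ∃ l', l'.length + 1 = l.length ∧ A = wsum l' := by
  -- the contraction with d
  have hcon : ∀ i, P i * Q d = (l.map (fun p => p.2 d * p.1 i + (- p.1 d) * p.2 i)).sum := by
    intro i
    have := h i d
    rw [hA4, wedge, hPd] at this
    simp only [mul_zero, sub_zero, zero_add] at this
    rw [this, wsum]
    congr 1
    apply List.map_congr_left
    intro p _
    simp only [wedge]; ring
  let L : List (((α → ℚ) × (α → ℚ)) × (ℚ × ℚ)) := l.map (fun p =>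
    ((fun i => p.1 i - p.1 c * (P i / P c), fun i => p.2 i - p.2 c * (P i / P c)), (p.2 d, - p.1 d)))
  have hL0 : ∀ i, (L.map (fun x => x.2.1 * x.1.1 i + x.2.2 * x.1.2 i)).sum = 0 := by
    intro i
    have e1 : (L.map (fun x => x.2.1 * x.1.1 i + x.2.2 * x.1.2 i)).sum =
        (l.map (fun p => p.2 d * p.1 i + (- p.1 d) * p.2 i)).sum
        - (P i / P c) * (l.map (fun p => p.2 d * p.1 c + (- p.1 d) * p.2 c)).sum := by
      clear hcon h
      induction l with
      | nil => simp [L]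
      | cons p l ih => simp [L] at ih ⊢; rw [ih]; ring
    rw [e1, ← hcon, ← hcon]
    field_simp; ring
  have hLn : ∃ x ∈ L, x.2 ≠ 0 := by
    by_contra hcontra
    push Not at hcontra
    have : P c * Q d = 0 := by
      rw [hcon c]
      apply List.sum_eq_zero
      intro x hx
      obtain ⟨p, hp, rfl⟩ := List.mem_map.1 hx
      have := hcontra _ (List.mem_map.2 ⟨p, hp, rfl⟩)
      simp only [Prod.mk_eq_zero] at this
      simp only [this.1, this.2]; ring
    exact (mul_ne_zero hPc hQd) this
  obtain ⟨l', h1, h2⟩ := drop_wedge L hLn hL0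
  refine ⟨l', by simpa [L] using h1, ?_⟩
  rw [h2]
  ext i j
  have e2 : wsum (L.map Prod.fst) i j = wsum l i j - (P i / P c) * wsum l c j
      - wsum l i c * (P j / P c) + (P i / P c) * wsum l c c * (P j / P c) := by
    clear hcon h hL0 hLn h2 h1
    induction l with
    | nil => simp [L]
    | cons p l ih =>
      simp only [L, List.map_cons, wsum_cons] at ih ⊢
      rw [ih]; simp only [wedge]; ring
  rw [e2, ← h, ← h, ← h, ← h, hA1, hA1, hA2]
  simp only [wedge]
  field_simp
  ring

end Heis
end QEq

namespace QEq
open Heis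
variable {α : Type} {G : Type} [Group G] {K : Type} [Group K]

lemma handle_id (U P V Q S T R : G) :
    U * (P * (V * (Q * (S * (P⁻¹ * (T * (Q⁻¹ * R))))))) =
    U * (T * (S * (V * R))) *
      (((V * R)⁻¹ * ((T * S)⁻¹ * P) * (V * R)) * ((V * R)⁻¹ * (V * Q * S) * (V * R)) *
       ((V * R)⁻¹ * ((T * S)⁻¹ * P) * (V * R))⁻¹ * ((V * R)⁻¹ * (V * Q * S) * (V * R))⁻¹) := by
  group

/-- commutator -/
def cm (p : G × G) : G := p.1 * p.2 * p.1⁻¹ * p.2⁻¹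

/-- product of conjugates -/
def pr (κ : α → G) (l : List (List (α × Bool) × G)) : G :=
  (l.map (fun p => p.2⁻¹ * ev κ p.1 * p.2)).prod

@[simp] lemma pr_nil (κ : α → G) : pr κ [] = 1 := rfl
@[simp] lemma pr_cons (κ : α → G) (p l) : pr κ (p :: l) = p.2⁻¹ * ev κ p.1 * p.2 * pr κ l := by
  simp [pr]
@[simp] lemma pr_append (κ : α → G) (l l') : pr κ (l ++ l') = pr κ l * pr κ l' := by
  simp [pr]

lemma extract {l : List (List (α × Bool) × G)} {w W} (h : (l.map Prod.fst).Perm (w :: W)) :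
    ∃ l1 z l2, l = l1 ++ (w, z) :: l2 ∧ ((l1 ++ l2).map Prod.fst).Perm W := by
  have : w ∈ l.map Prod.fst := h.symm.subset (by simp)
  obtain ⟨⟨w', z⟩, hm, hw⟩ := List.mem_map.1 this
  simp only at hw
  subst hw
  obtain ⟨l1, l2, rfl⟩ := List.append_of_mem hm
  refine ⟨l1, z, l2, rfl, ?_⟩
  have h2 : ((l1 ++ (w', z) :: l2).map Prod.fst).Perm (w' :: ((l1 ++ l2).map Prod.fst)) := by
    simpa using List.perm_middle
  exact (h2.symm.trans h).cons_inv

lemma pr_extract (κ : α → G) (l1 l2 : List (List (α × Bool) × G)) (w z) :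
    pr κ (l1 ++ (w, z) :: l2) =
      ((z * (pr κ l1)⁻¹)⁻¹ * ev κ w * (z * (pr κ l1)⁻¹)) * pr κ (l1 ++ l2) := by
  simp; group

/-- size of a list of words -/
def sz (W : List (List (α × Bool))) : ℕ := (W.map (fun w => w.length + 2)).sum

lemma pr_map (φ : G →* K) (κ : α → G) (l : List (List (α × Bool) × G)) :
    φ (pr κ l) = (l.map (fun p => (φ p.2)⁻¹ * φ (ev κ p.1) * φ p.2)).prod := by
  induction l with
  | nil => simp
  | cons p l ih => simp [ih]

lemma pr_conj (κ : α → G) (l : List (List (α × Bool) × G)) (h : G) :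
    pr κ (l.map (fun p => (p.1, p.2 * h))) = h⁻¹ * pr κ l * h := by
  induction l with
  | nil => simp
  | cons p l ih => simp [ih]; group

variable [DecidableEq α]

lemma perm_handle (u v s t r : List (α × Bool)) (p q p' q' : α × Bool) :
    (u ++ p :: (v ++ q :: (s ++ p' :: (t ++ q' :: r)))).Perm
      (p :: p' :: q :: q' :: (u ++ (t ++ (s ++ (v ++ r))))) := by
  rw [List.perm_iff_count]
  intro a
  simp only [List.count_append, List.count_cons]
  omega

lemma ev_e_v (w : List (α × Bool)) (j : α) :
    (ev e w).v j = (w.count (j, true) : ℚ) - w.count (j, false) := by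
  induction w with
  | nil => simp
  | cons l w ih =>
    rcases l with ⟨a, b⟩
    by_cases h : a = j
    · subst h
      cases b <;> simp [ih, lv, e] <;> ring
    · have h' : j ≠ a := fun h' => h h'.symm
      cases b <;> simp [ih, lv, e, h, h', List.count_cons]

lemma lv_e_v (l : α × Bool) {j : α} (h : l.1 ≠ j) : (lv e l).v j = 0 := by
  unfold lv; split <;> simp [e, h.symm]

lemma lv_e_m (l : α × Bool) {j : α} (h : l.1 ≠ j) (i) : (lv e l).m i j = 0 ∧ (lv e l).m j i = 0 := by
  unfold lv; split <;> simp [e, h.symm]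

lemma lv_e_self (l : α × Bool) : (lv e l).v l.1 ≠ 0 := by
  unfold lv; split <;> simp [e]

lemma ev_e_v0 (w : List (α × Bool)) {j : α} (h : ∀ l ∈ w, l.1 ≠ j) : (ev e w).v j = 0 := by
  induction w with
  | nil => simp
  | cons l w ih =>
    simp only [List.mem_cons, forall_eq_or_imp] at h
    simp [ih h.2, lv_e_v l h.1]

lemma ev_e_m0 (w : List (α × Bool)) {j : α} (h : ∀ l ∈ w, l.1 ≠ j) (i) :
    (ev e w).m i j = 0 ∧ (ev e w).m j i = 0 := by
  induction w with
  | nil => simp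
  | cons l w ih =>
    simp only [List.mem_cons, forall_eq_or_imp] at h
    simp [ih h.2, lv_e_v l h.1, lv_e_m l h.1, ev_e_v0 w h.2]

lemma norm_ev_of (w : List (α × Bool)) : (ev FreeGroup.of w).norm ≤ w.length := by
  rw [ev_of]; exact FreeGroup.norm_mk_le

lemma norm_lv_of (l : α × Bool) : (lv FreeGroup.of l).norm ≤ 1 := by
  unfold lv; split <;> simp

lemma stage4 (N : ℕ) : ∀ (n : ℕ) (w : List (α × Bool)) (k : ℕ), w.length ≤ n → w.length ≤ N →
    Bal (fun _ => True) w → HT k (ev e w) →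
    ∃ C : List (FreeGroup α × FreeGroup α), C.length = k ∧
      (∀ p ∈ C, p.1.norm ≤ 3 * N ∧ p.2.norm ≤ 3 * N) ∧
      ev FreeGroup.of w * (C.map cm).prod = 1 := by
  intro n
  induction n with
  | zero =>
    intro w k hw _ _ _
    have : w = [] := List.length_eq_zero_iff.1 (by omega)
    subst this
    refine ⟨List.replicate k (1, 1), by simp, ?_, by simp [cm]⟩
    intro p hp
    rw [List.eq_of_mem_replicate hp]; simp
  | succ n ih =>
    intro w k hw hN hB hT
    rcases chord hB with h | ⟨u, p, m, z, rfl, -, h⟩ | ⟨u, p, v, q, s, t, r, rfl, -, -⟩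
    · refine ih w k ?_ hN hB hT
      have : w = [] := List.eq_nil_iff_forall_not_mem.2 (fun l hl => h l hl trivial)
      simp [this]
    · have hm : m = [] := List.eq_nil_iff_forall_not_mem.2 (fun l hl => h l hl trivial)
      subst hm
      have hB' : Bal (fun _ => True) (u ++ z) := by
        refine Bal.tail (p := p) (hB.perm ?_)
        rw [List.perm_iff_count]
        intro a
        simp only [List.count_append, List.count_cons, List.nil_append]
        omega
      obtain ⟨C, h1, h2, h3⟩ := ih (u ++ z) k (by simp at hw ⊢; omega) (by simp at hN ⊢; omega) hB'
        (by simpa using hT)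
      exact ⟨C, h1, h2, by simpa using h3⟩
    · have hB1 := hB.perm (perm_handle u v s t r p q (iv p) (iv q))
      have hp := hB1.notin trivial
      have hB2 := hB1.tail
      have hq := hB2.notin trivial
      have hB3 := hB2.tail
      simp only [List.mem_cons, List.mem_append] at hp hq
      have hid : ∀ {G : Type} [Group G] (f : α → G), _ := fun f =>
        handle_id (ev f u) (lv f p) (ev f v) (lv f q) (ev f s) (ev f t) (ev f r)
      have hev : ∀ {G : Type} [Group G] (f : α → G),
        ev f (u ++ p :: (v ++ q :: (s ++ iv p :: (t ++ iv q :: r)))) = _ := fun f => by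
        simp only [ev_append, ev_cons, lv_iv]
        exact hid f
      have hev' : ∀ {G : Type} [Group G] (f : α → G), ev f (u ++ (t ++ (s ++ (v ++ r)))) =
        ev f u * (ev f t * (ev f s * (ev f v * ev f r))) := fun f => by simp
      obtain ⟨hT0, l, hl, hTm⟩ := hT
      rw [hev e, comm_eq, ← hev'] at hT0 hTm
      obtain ⟨l', hl', hA⟩ := reduce_wedge (A := (ev e (u ++ (t ++ (s ++ (v ++ r))))).m)
        (P := ((ev e v * ev e r)⁻¹ * ((ev e t * ev e s)⁻¹ * lv e p) * (ev e v * ev e r)).v)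
        (Q := ((ev e v * ev e r)⁻¹ * (ev e v * lv e q * ev e s) * (ev e v * ev e r)).v)
        (c := p.1) (d := q.1)
        (by
          have h1 := ev_e_v0 t (j := p.1) (fun l hl => hp l (by tauto))
          have h2 := ev_e_v0 s (j := p.1) (fun l hl => hp l (by tauto))
          have h3 := lv_e_self p
          intro h
          apply h3
          simp [h1, h2] at h
          linarith)
        (by
          have h1 := ev_e_v0 t (j := q.1) (fun l hl => hq l (by tauto))
          have h2 := ev_e_v0 s (j := q.1) (fun l hl => hq l (by tauto))
          have h3 := lv_e_v p (j := q.1) (fun h => hp q (by tauto) h.symm)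
          simp [h1, h2, h3])
        (by
          have h1 := ev_e_v0 v (j := q.1) (fun l hl => hq l (by tauto))
          have h2 := ev_e_v0 s (j := q.1) (fun l hl => hq l (by tauto))
          simp [h1, h2, lv_e_self])
        (fun i => (ev_e_m0 _ (fun l hl => hp l (by
          simp only [List.mem_append] at hl; tauto)) i).2)
        (fun i => (ev_e_m0 _ (fun l hl => hp l (by
          simp only [List.mem_append] at hl; tauto)) i).1)
        (fun i => (ev_e_m0 _ (fun l hl => hq l (by
          simp only [List.mem_append] at hl; tauto)) i).1) l
        (by
          intro i j
          have := congrFun (congrFun hTm i) j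
          rw [← this]
          simp)
      have hv0 : (ev e (u ++ (t ++ (s ++ (v ++ r))))).v = 0 := by simpa using hT0
      obtain ⟨C, h1, h2, h3⟩ := ih (u ++ (t ++ (s ++ (v ++ r)))) (k - 1)
        (by simp at hw ⊢; omega) (by simp at hN ⊢; omega) hB3 ⟨hv0, l', by omega, hA⟩
      have nu := norm_ev_of u
      have nv := norm_ev_of v
      have ns := norm_ev_of s
      have nt := norm_ev_of t
      have nr := norm_ev_of r
      have np := norm_lv_of p
      have nq := norm_lv_of q
      simp only [List.length_append, List.length_cons] at hN
      refine ⟨(((ev FreeGroup.of v * ev FreeGroup.of r)⁻¹ * (ev FreeGroup.of v * lv FreeGroup.of q * ev FreeGroup.of s) * (ev FreeGroup.of v * ev FreeGroup.of r)), ((ev FreeGroup.of v * ev FreeGroup.of r)⁻¹ * ((ev FreeGroup.of t * ev FreeGroup.of s)⁻¹ * lv FreeGroup.of p) * (ev FreeGroup.of v * ev FreeGroup.of r))) :: C, by simp; omega, ?_, ?_⟩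
      · intro x hx
        rcases List.mem_cons.1 hx with rfl | hx
        · constructor
          · refine (FreeGroup.norm_mul_le _ _).trans ?_
            have a1 := FreeGroup.norm_mul_le (ev FreeGroup.of v * ev FreeGroup.of r)⁻¹ (ev FreeGroup.of v * lv FreeGroup.of q * ev FreeGroup.of s)
            have a2 := FreeGroup.norm_mul_le (ev FreeGroup.of v * lv FreeGroup.of q) (ev FreeGroup.of s)
            have a3 := FreeGroup.norm_mul_le (ev FreeGroup.of v) (lv FreeGroup.of q)
            have a4 := FreeGroup.norm_mul_le (ev FreeGroup.of v) (ev FreeGroup.of r)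
            rw [FreeGroup.norm_inv_eq] at a1
            omega
          · refine (FreeGroup.norm_mul_le _ _).trans ?_
            have a1 := FreeGroup.norm_mul_le (ev FreeGroup.of v * ev FreeGroup.of r)⁻¹ ((ev FreeGroup.of t * ev FreeGroup.of s)⁻¹ * lv FreeGroup.of p)
            have a2 := FreeGroup.norm_mul_le (ev FreeGroup.of t * ev FreeGroup.of s)⁻¹ (lv FreeGroup.of p)
            have a3 := FreeGroup.norm_mul_le (ev FreeGroup.of t) (ev FreeGroup.of s)
            have a4 := FreeGroup.norm_mul_le (ev FreeGroup.of v) (ev FreeGroup.of r)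
            rw [FreeGroup.norm_inv_eq] at a1 a2
            omega
        · exact h2 x hx
      · rw [hev FreeGroup.of, ← hev', List.map_cons, List.prod_cons, ← h3]
        simp only [cm]
        group

lemma prj_ev (c : α) (q) (w : List (α × Bool)) (h : ∀ l ∈ w, l.1 ≠ c) :
    prj c q (ev e w) = ev e w := by
  rw [map_ev]
  exact ev_congr (fun l hl => prj_e q (h l hl))

lemma prj_pr (c : α) (q) (l : List (List (α × Bool) × Heis α))
    (h : ∀ p ∈ l, ∀ x ∈ p.1, x.1 ≠ c) :
    prj c q (pr e l) = pr e (l.map (fun p => (p.1, prj c q p.2))) := by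
  induction l with
  | nil => simp
  | cons p l ih =>
    simp only [List.mem_cons, forall_eq_or_imp] at h
    simp [ih h.2, prj_ev c q p.1 h.1]

lemma stage3 (N : ℕ) : ∀ (n : ℕ) (W : List (List (α × Bool))) (w0 : List (α × Bool)) (k : ℕ),
    W.length = n → w0.length + sz W ≤ N →
    Bal (fun _ => True) (w0 ++ W.flatten) →
    (∃ l, (l.map Prod.fst).Perm W ∧ HT k (ev e w0 * pr e l)) →
    ∃ (l : List (List (α × Bool) × FreeGroup α)) (C : List (FreeGroup α × FreeGroup α)),
      (l.map Prod.fst).Perm W ∧ (∀ p ∈ l, p.2.norm ≤ 3 * N) ∧ C.length = k ∧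
      (∀ p ∈ C, p.1.norm ≤ 3 * N ∧ p.2.norm ≤ 3 * N) ∧
      ev FreeGroup.of w0 * pr FreeGroup.of l * (C.map cm).prod = 1 := by
  intro n
  induction n with
  | zero =>
    intro W w0 k hn hN hB ⟨l, hl, hT⟩
    have : W = [] := List.length_eq_zero_iff.1 hn
    subst this
    have : l = [] := by simpa using hl
    subst this
    obtain ⟨C, h1, h2, h3⟩ := stage4 N w0.length w0 k le_rfl (by omega) (by simpa using hB)
      (by simpa using hT)
    exact ⟨[], C, by simp, by simp, h1, h2, by simpa using h3⟩
  | succ n ih =>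
    intro W w0 k hn hN hB ⟨l, hl, hT⟩
    by_cases hv : (ev e w0).v = 0
    · -- closed case
      obtain ⟨w, W', rfl⟩ : ∃ w W', W = w :: W' := by
        cases W with
        | nil => simp at hn
        | cons w W' => exact ⟨w, W', rfl⟩
      obtain ⟨l1, z, l2, rfl, hp⟩ := extract hl
      rw [pr_extract] at hT
      set h := z * (pr e l1)⁻¹ with hh
      have hT' : HT k (ev e (w0 ++ w) * pr e ((l1 ++ l2).map (fun p => (p.1, p.2 * h⁻¹)))) := by
        rw [pr_conj, ev_append]
        have hc := Heis.central hT.1 h⁻¹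
        have hc2 := Heis.central hv h⁻¹
        convert hT using 1
        have : ev e w0 * ev e w * (h⁻¹⁻¹ * pr e (l1 ++ l2) * h⁻¹) =
          h * ((h⁻¹ * ev e w0) * ev e w * h * pr e (l1 ++ l2)) * h⁻¹ := by group
        rw [this, ← hc2]
        have : h * (ev e w0 * h⁻¹ * ev e w * h * pr e (l1 ++ l2)) * h⁻¹ =
          h * ((ev e w0 * (h⁻¹ * ev e w * h * pr e (l1 ++ l2))) * h⁻¹) := by group
        rw [this, hc]; group
      obtain ⟨l', C, a1, a2, a3, a4, a5⟩ := ih W' (w0 ++ w) k (by simpa using hn)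
        (by simp [sz] at hN ⊢; omega) (by simpa using hB) ⟨_, by simpa [Function.comp_def] using hp, hT'⟩
      refine ⟨(w, 1) :: l', C, by simpa using a1, ?_, a3, a4, ?_⟩
      · intro p hp
        rcases List.mem_cons.1 hp with rfl | hp
        · simp
        · exact a2 p hp
      · refine Eq.trans ?_ a5; simp [mul_assoc]
    · -- joining
      obtain ⟨j, hj⟩ : ∃ j, (ev e w0).v j ≠ 0 := by
        by_contra hcon
        push Not at hcon
        exact hv (funext hcon)
      rw [ev_e_v] at hj
      have hBj := hB j trivial
      simp only [List.count_append] at hBj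
      -- p ∈ w0, iv p ∈ flatten
      obtain ⟨p, hpj, hp0, hpW⟩ : ∃ p : α × Bool, p.1 = j ∧ p ∈ w0 ∧ iv p ∈ W.flatten := by
        have hne : w0.count (j, true) ≠ w0.count (j, false) := by
          intro h; apply hj; rw [h]; ring
        rcases lt_or_gt_of_ne hne with hlt | hlt
        · exact ⟨(j, false), rfl, List.count_pos_iff.1 (by omega), by
            simp only [iv, Bool.not_false]
            exact List.count_pos_iff.1 (by omega)⟩
        · exact ⟨(j, true), rfl, List.count_pos_iff.1 (by omega), by
            simp only [iv, Bool.not_true]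
            exact List.count_pos_iff.1 (by omega)⟩
      obtain ⟨w, hwW, hpw⟩ := List.mem_flatten.1 hpW
      obtain ⟨μ, ν, rfl⟩ := List.append_of_mem hp0
      obtain ⟨κ, lam, rfl⟩ := List.append_of_mem hpw
      obtain ⟨W1, W2, rfl⟩ := List.append_of_mem hwW
      have hWp : (W1 ++ (κ ++ iv p :: lam) :: W2).Perm ((κ ++ iv p :: lam) :: (W1 ++ W2)) :=
        List.perm_middle
      have hB1 : Bal (fun _ => True) (p :: iv p :: ((μ ++ (lam ++ (κ ++ ν))) ++ (W1 ++ W2).flatten)) := by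
        refine hB.perm ?_
        rw [List.perm_iff_count]
        intro a
        simp only [List.count_append, List.count_cons, List.flatten_append, List.flatten_cons]
        omega
      have hn1 := hB1.notin trivial
      have hB2 := hB1.tail
      obtain ⟨l1, z, l2, rfl, hp⟩ := extract (hl.trans hWp)
      rw [pr_extract] at hT
      set h := z * (pr e l1)⁻¹ with hh
      set w := κ ++ iv p :: lam with hw
      have hwc : (ev e w).v p.1 ≠ 0 := by
        have h1 := ev_e_v0 κ (j := p.1) (fun l hl => hn1 l (by simp [hl]))
        have h2 := ev_e_v0 lam (j := p.1) (fun l hl => hn1 l (by simp [hl]))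
        have h3 := lv_e_self (iv p)
        simp only [iv_fst] at h3
        simp only [hw, ev_append, ev_cons, mul_v, Pi.add_apply, h1, h2]
        simpa using h3
      let q : α → ℚ := fun i => (ev e w).v i / (ev e w).v p.1
      have hπ0 : (prj p.1 q (ev e w)).v = 0 := by
        ext i
        rw [prj_v]; simp only [q, Pi.zero_apply]; field_simp; ring
      have hT1 := hT.prj p.1 q
      have hmem : ∀ x ∈ l1 ++ l2, ∀ y ∈ x.1, y.1 ≠ p.1 := by
        intro x hx y hy
        apply hn1
        rw [List.mem_append]; right
        refine List.mem_flatten.2 ⟨x.1, hp.subset (List.mem_map_of_mem hx), hy⟩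
      have hT2 : HT k (ev e (μ ++ (lam ++ (κ ++ ν))) *
          pr e ((l1 ++ l2).map (fun x => (x.1, prj p.1 q x.2)))) := by
        rw [← prj_pr _ _ _ hmem]
        rw [← prj_ev p.1 q (μ ++ (lam ++ (κ ++ ν))) (fun l hl => hn1 l (List.mem_append_left _ hl))]
        convert hT1 using 1
        simp only [map_mul, map_inv, ← mul_assoc]
        congr 1
        have c1 := Heis.central hπ0 (prj p.1 q h)
        have e1 : prj p.1 q (ev e (μ ++ p :: ν)) * (prj p.1 q h)⁻¹ * prj p.1 q (ev e w) * prj p.1 q h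
          = prj p.1 q (ev e (μ ++ p :: ν)) * prj p.1 q (ev e w) := by
          rw [mul_assoc, c1]; group
        rw [e1]
        have c2 := Heis.central hπ0 (prj p.1 q (ev e κ * ev e ν))
        have e2 : prj p.1 q (ev e w) = (prj p.1 q (ev e κ * ev e ν))⁻¹ * prj p.1 q (ev e w)
            * prj p.1 q (ev e κ * ev e ν) := by
          rw [mul_assoc, c2]; group
        rw [e2, ← map_inv, ← map_mul, ← map_mul, ← map_mul]
        congr 1
        simp only [hw, ev_append, ev_cons, lv_iv]
        group
      obtain ⟨l', C, a1, a2, a3, a4, a5⟩ := ih (W1 ++ W2) (μ ++ (lam ++ (κ ++ ν))) k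
        (by simp at hn ⊢; omega)
        (by simp [sz, hw] at hN ⊢; omega) hB2 ⟨_, by simpa [Function.comp_def] using hp, hT2⟩
      refine ⟨(w, ev FreeGroup.of κ * ev FreeGroup.of ν) :: l', C, ?_, ?_, a3, a4, ?_⟩
      · exact (List.Perm.cons _ a1).trans hWp.symm
      · intro x hx
        rcases List.mem_cons.1 hx with rfl | hx
        · have b1 := norm_ev_of κ
          have b2 := norm_ev_of ν
          have b3 := FreeGroup.norm_mul_le (ev FreeGroup.of κ) (ev FreeGroup.of ν)
          simp [sz, hw] at hN ⊢
          omega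
        · exact a2 x hx
      · rw [← a5]
        simp only [hw, ev_append, ev_cons, lv_iv, pr_cons]
        group

end QEq

namespace QEq
open Heis
variable {α : Type} [DecidableEq α]

lemma nmul {a b : FreeGroup α} {x y : ℕ} (ha : a.norm ≤ x) (hb : b.norm ≤ y) :
    (a * b).norm ≤ x + y :=
  (FreeGroup.norm_mul_le a b).trans (Nat.add_le_add ha hb)

lemma ninv {a : FreeGroup α} {x : ℕ} (ha : a.norm ≤ x) : (a⁻¹).norm ≤ x := by
  rwa [FreeGroup.norm_inv_eq]

lemma suf {β : Type} {s a b : List β} (h : s <:+ a ++ b) :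
    s <:+ b ∨ ∃ a', a' <:+ a ∧ s = a' ++ b := by
  induction a with
  | nil => left; simpa using h
  | cons x a ih =>
    rw [List.cons_append, List.suffix_cons_iff] at h
    rcases h with h | h
    · right; exact ⟨x :: a, List.suffix_refl _, by simpa using h⟩
    · rcases ih h with h | ⟨a', h1, h2⟩
      · exact Or.inl h
      · exact Or.inr ⟨a', h1.trans (List.suffix_cons _ _), h2⟩

lemma sufc {β : Type} {s a b : List β} {c : β} (h : s <:+ a ++ c :: b) :
    s <:+ b ∨ ∃ a', a' <:+ a ∧ s = a' ++ c :: b := by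
  rcases suf h with h | h
  · rw [List.suffix_cons_iff] at h
    rcases h with h | h
    · exact Or.inr ⟨[], List.nil_suffix, by simpa using h⟩
    · exact Or.inl h
  · exact Or.inr h

lemma norm_pr (L : ℕ) (l : List (List (α × Bool) × FreeGroup α)) (h : ∀ p ∈ l, p.2.norm ≤ L) :
    (pr FreeGroup.of l).norm ≤ sz (l.map Prod.fst) * (L + 1) := by
  induction l with
  | nil => simp
  | cons p l ih =>
    simp only [List.mem_cons, forall_eq_or_imp] at h
    have h1 := ih h.2
    rw [pr_cons]
    refine (nmul (nmul (nmul (ninv h.1) (norm_ev_of p.1)) h.1) h1).trans ?_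
    simp only [sz, List.map_cons, List.sum_cons]
    nlinarith [Nat.zero_le (p.1.length * L)]

lemma sz_perm {W W' : List (List (α × Bool))} (h : W.Perm W') : sz W = sz W' :=
  (h.map _).sum_eq

/-- assign a value to a letter -/
def upd {G : Type} [Group G] (f : α → G) (p : α × Bool) (g : G) : α → G :=
  Function.update f p.1 (if p.2 then g else g⁻¹)

lemma lv_upd {G : Type} [Group G] (f : α → G) (p : α × Bool) (g : G) : lv (upd f p g) p = g := by
  rcases p with ⟨a, b⟩; cases b <;> simp [upd, lv]

lemma upd_ne {G : Type} [Group G] (f : α → G) (p : α × Bool) (g : G) {a : α} (h : a ≠ p.1) :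
    upd f p g a = f a := by
  simp [upd, h]

lemma ev_upd {G : Type} [Group G] (f : α → G) (p : α × Bool) (g : G) {w : List (α × Bool)}
    (h : ∀ l ∈ w, l.1 ≠ p.1) : ev (upd f p g) w = ev f w :=
  ev_congr (fun l hl => upd_ne f p g (h l hl))

/-- solvable in the Heisenberg-type group -/
def HS (V : α → Prop) (k : ℕ) (Q : List (α × Bool)) (W : List (List (α × Bool))) : Prop :=
  ∃ f : α → Heis α, (∀ c, ¬ V c → f c = e c) ∧
    ∃ l, (l.map Prod.fst).Perm W ∧ HT k (ev f Q * pr e l)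

/-- has a short solution -/
def Short (V : α → Prop) (L D k : ℕ) (Q : List (α × Bool)) (W : List (List (α × Bool))) : Prop :=
  ∃ f : α → FreeGroup α, (∀ c, ¬ V c → f c = FreeGroup.of c) ∧
    ∃ (l : List (List (α × Bool) × FreeGroup α)) (C : List (FreeGroup α × FreeGroup α)),
      (l.map Prod.fst).Perm W ∧ (∀ p ∈ l, p.2.norm ≤ L) ∧ C.length = k ∧
      (∀ p ∈ C, p.1.norm ≤ L ∧ p.2.norm ≤ L) ∧
      ev f Q * pr FreeGroup.of l * (C.map cm).prod = 1 ∧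
      ∀ s, s <:+ Q → (ev f s).norm ≤ D

lemma HS.inner {V : α → Prop} {k : ℕ} {u m z : List (α × Bool)} {p : α × Bool}
    {W : List (List (α × Bool))} (hm : ∀ l ∈ m, ¬ V l.1)
    (h : HS V k (u ++ p :: (m ++ iv p :: z)) W) : HS V k (u ++ z) (m :: W) := by
  obtain ⟨f, hf, l, hl, hT⟩ := h
  refine ⟨f, hf, (m, (lv f p)⁻¹ * ev f z) :: l, by simpa using hl, ?_⟩
  convert hT using 1
  have : ev e m = ev f m := ev_congr (fun x hx => (hf _ (hm x hx)).symm)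
  simp only [ev_append, ev_cons, pr_cons, lv_iv, this]
  group

lemma Short.inner {V : α → Prop} {L D N k : ℕ} {u m z : List (α × Bool)} {p : α × Bool}
    {W : List (List (α × Bool))} (hp : V p.1) (hm : ∀ l ∈ m, ¬ V l.1)
    (hn : ∀ l ∈ u ++ (m ++ z), l.1 ≠ p.1) (hN : sz (m :: W) ≤ N)
    (h : Short V L D k (u ++ z) (m :: W)) :
    Short V L (D + (2 * (L + N * (L + 1)) + N)) k (u ++ p :: (m ++ iv p :: z)) W := by
  obtain ⟨f, hf, l, C, h1, h2, h3, h4, h5, h6⟩ := h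
  obtain ⟨l1, y, l2, rfl, hp2⟩ := extract h1
  have hy : y.norm ≤ L := h2 (m, y) (by simp)
  have hl1 : (pr FreeGroup.of l1).norm ≤ N * (L + 1) := by
    refine (norm_pr L l1 (fun x hx => h2 x (by simp [hx]))).trans ?_
    refine Nat.mul_le_mul_right _ ?_
    have e1 := sz_perm h1
    have : sz ((l1 ++ (m, y) :: l2).map Prod.fst) = sz (l1.map Prod.fst) +
      sz (((m, y) :: l2).map Prod.fst) := by simp [sz]
    omega
  rw [pr_extract] at h5
  have hX : (y * (pr FreeGroup.of l1)⁻¹).norm ≤ L + N * (L + 1) := nmul hy (ninv hl1)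
  generalize y * (pr FreeGroup.of l1)⁻¹ = x at h5 hX
  simp only [List.mem_append] at hn
  have eu : ∀ g, ∀ u', u' <:+ u → ev (upd f p g) u' = ev f u' := fun g u' hu' =>
    ev_upd f p g (fun l hl => hn l (Or.inl (hu'.subset hl)))
  have ez : ∀ g, ∀ u', u' <:+ z → ev (upd f p g) u' = ev f u' := fun g u' hu' =>
    ev_upd f p g (fun l hl => hn l (Or.inr (Or.inr (hu'.subset hl))))
  have em : ∀ g, ∀ u', u' <:+ m → ev (upd f p g) u' = ev FreeGroup.of u' := fun g u' hu' =>
    (ev_upd f p g (fun l hl => hn l (Or.inr (Or.inl (hu'.subset hl))))).trans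
      (ev_congr (fun l hl => hf _ (hm l (hu'.subset hl))))
  have hmN : m.length ≤ N := by simp [sz] at hN; omega
  refine ⟨upd f p (ev f z * x⁻¹), ?_, l1 ++ l2, C, hp2, ?_, h3, h4, ?_, ?_⟩
  · intro c hc
    rw [upd_ne _ _ _ (by rintro rfl; exact hc hp), hf c hc]
  · intro q hq
    refine h2 q ?_
    simp only [List.mem_append, List.mem_cons] at hq ⊢
    tauto
  · rw [← h5]
    simp only [ev_append, ev_cons, lv_iv, lv_upd, eu _ u (List.suffix_refl _),
      em _ m (List.suffix_refl _), ez _ z (List.suffix_refl _)]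
    group
  · intro s hs
    rcases sufc hs with hs | ⟨u', hu', rfl⟩
    · rcases sufc hs with hs | ⟨m', hm', rfl⟩
      · rw [ez _ s hs]
        refine (h6 s (hs.trans (List.suffix_append _ _))).trans (by omega)
      · simp only [ev_append, ev_cons, lv_iv, lv_upd, em _ m' hm', ez _ z (List.suffix_refl _)]
        have : ev FreeGroup.of m' * ((ev f z * x⁻¹)⁻¹ * ev f z) = ev FreeGroup.of m' * x := by group
        rw [this]
        have h7 := nmul ((norm_ev_of m').trans hm'.length_le) hX
        omega
    · simp only [ev_append, ev_cons, lv_iv, lv_upd, eu _ u' hu', em _ m (List.suffix_refl _),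
        ez _ z (List.suffix_refl _)]
      have : ev f u' * (ev f z * x⁻¹ * (ev FreeGroup.of m * ((ev f z * x⁻¹)⁻¹ * ev f z))) =
        ev f (u' ++ z) * (x⁻¹ * ev FreeGroup.of m * x) := by
        rw [ev_append]; group
      rw [this]
      obtain ⟨u0, rfl⟩ := hu'
      have h7 := nmul (h6 (u' ++ z) ⟨u0, by simp⟩) (nmul (nmul (ninv hX) (norm_ev_of m)) hX)
      omega

lemma HS.handle {V : α → Prop} {k : ℕ} {u v s t r : List (α × Bool)} {p q : α × Bool}
    {W : List (List (α × Bool))}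
    (h : HS V k (u ++ p :: (v ++ q :: (s ++ iv p :: (t ++ iv q :: r)))) W) :
    HS V (k + 1) (u ++ (t ++ (s ++ (v ++ r)))) W := by
  obtain ⟨f, hf, l, hl, hT⟩ := h
  refine ⟨f, hf, l, hl, ?_⟩
  have hev := handle_id (ev f u) (lv f p) (ev f v) (lv f q) (ev f s) (ev f t) (ev f r)
  rw [comm_eq] at hev
  have hev1 : ev f (u ++ p :: (v ++ q :: (s ++ iv p :: (t ++ iv q :: r)))) =
    ev f u * (lv f p * (ev f v * (lv f q * (ev f s * ((lv f p)⁻¹ * (ev f t * ((lv f q)⁻¹ * ev f r)))))))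
    := by simp
  rw [hev1, hev] at hT
  have hev2 : ev f (u ++ (t ++ (s ++ (v ++ r)))) =
    ev f u * (ev f t * (ev f s * (ev f v * ev f r))) := by simp
  rw [hev2]
  generalize ((ev f v * ev f r)⁻¹ * ((ev f t * ev f s)⁻¹ * lv f p) * (ev f v * ev f r)).v = P at hT
  generalize ((ev f v * ev f r)⁻¹ * (ev f v * lv f q * ev f s) * (ev f v * ev f r)).v = Q at hT
  generalize ev f u * (ev f t * (ev f s * (ev f v * ev f r))) = X at hT ⊢
  generalize pr e l = Y at hT ⊢
  obtain ⟨h0, l', hl', hm⟩ := hT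
  refine ⟨by simpa using h0, (Q, P) :: l', by simp [hl'], ?_⟩
  funext i j
  have := congrFun (congrFun hm i) j
  rw [wsum_cons, ← this]
  simp [wedge]
  ring

lemma Short.handle {V : α → Prop} {L D N k : ℕ} {u v s t r : List (α × Bool)} {p q : α × Bool}
    {W : List (List (α × Bool))} (hp : V p.1) (hq : V q.1)
    (hn : ∀ l ∈ q :: (u ++ (t ++ (s ++ (v ++ r)))), l.1 ≠ p.1)
    (hn2 : ∀ l ∈ u ++ (t ++ (s ++ (v ++ r))), l.1 ≠ q.1) (hN : sz W ≤ N)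
    (h : Short V L D (k + 1) (u ++ (t ++ (s ++ (v ++ r)))) W) :
    Short V L (D + 4 * (L + 2 * (N * (L + 1)))) k
      (u ++ p :: (v ++ q :: (s ++ iv p :: (t ++ iv q :: r)))) W := by
  obtain ⟨f, hf, l, C, h1, h2, h3, h4, h5, h6⟩ := h
  obtain ⟨⟨a0, b0⟩, C', rfl⟩ : ∃ c C', C = c :: C' := by
    cases C with
    | nil => simp at h3
    | cons c C' => exact ⟨c, C', rfl⟩
  have hPi : (pr FreeGroup.of l).norm ≤ N * (L + 1) := by
    refine (norm_pr L l h2).trans (Nat.mul_le_mul_right _ ?_)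
    rw [sz_perm h1]; exact hN
  have hab := h4 (a0, b0) (by simp)
  set b := pr FreeGroup.of l * a0 * (pr FreeGroup.of l)⁻¹ with hb
  set a := pr FreeGroup.of l * b0 * (pr FreeGroup.of l)⁻¹ with ha
  set B := L + 2 * (N * (L + 1)) with hB
  have nb : b.norm ≤ B := (nmul (nmul hPi hab.1) (ninv hPi)).trans (by omega)
  have na : a.norm ≤ B := (nmul (nmul hPi hab.2) (ninv hPi)).trans (by omega)
  have hqp := hn q (by simp)
  have hn1 : ∀ l ∈ u ++ (t ++ (s ++ (v ++ r))), l.1 ≠ p.1 := fun l hl => hn l (by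
    rw [List.mem_cons]; exact Or.inr hl)
  set F := upd (upd f q (ev f r * a * (ev f s * ev f v * ev f r)⁻¹)) p
    (ev f t * ev f s * ev f v * ev f r * b * (ev f v * ev f r)⁻¹) with hF
  have eF : ∀ w : List (α × Bool), (∀ l ∈ w, l ∈ u ++ (t ++ (s ++ (v ++ r)))) → ev F w = ev f w := by
    intro w hw
    rw [hF, ev_upd _ _ _ (fun l hl => hn1 l (hw l hl)), ev_upd _ _ _ (fun l hl => hn2 l (hw l hl))]
  have Fp : lv F p = ev f t * ev f s * ev f v * ev f r * b * (ev f v * ev f r)⁻¹ := lv_upd _ _ _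
  have Fq : lv F q = ev f r * a * (ev f s * ev f v * ev f r)⁻¹ := by
    rw [hF, lv_congr (g := upd f q (ev f r * a * (ev f s * ev f v * ev f r)⁻¹)), lv_upd]
    exact upd_ne _ _ _ hqp
  have eu : ∀ w, w <:+ u → ev F w = ev f w := fun w hw => eF w (fun l hl => by
    simp [hw.subset hl])
  have et : ∀ w, w <:+ t → ev F w = ev f w := fun w hw => eF w (fun l hl => by
    simp [hw.subset hl])
  have es : ∀ w, w <:+ s → ev F w = ev f w := fun w hw => eF w (fun l hl => by
    simp [hw.subset hl])
  have evv : ∀ w, w <:+ v → ev F w = ev f w := fun w hw => eF w (fun l hl => by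
    simp [hw.subset hl])
  have er : ∀ w, w <:+ r → ev F w = ev f w := fun w hw => eF w (fun l hl => by
    simp [hw.subset hl])
  refine ⟨F, ?_, l, C', h1, h2, by simpa using h3, fun c hc => h4 c (by simp [hc]), ?_, ?_⟩
  · intro c hc
    rw [hF, upd_ne _ _ _ (by rintro rfl; exact hc hp), upd_ne _ _ _ (by rintro rfl; exact hc hq),
      hf c hc]
  · rw [← h5]
    simp only [ev_append, ev_cons, lv_iv, Fp, Fq, eu _ (List.suffix_refl _),
      et _ (List.suffix_refl _), es _ (List.suffix_refl _), evv _ (List.suffix_refl _),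
      er _ (List.suffix_refl _), List.map_cons, List.prod_cons, cm, hb, ha]
    group
  · intro x hx
    rcases sufc hx with hx | ⟨u', hu', rfl⟩
    · rcases sufc hx with hx | ⟨u', hu', rfl⟩
      · rcases sufc hx with hx | ⟨u', hu', rfl⟩
        · rcases sufc hx with hx | ⟨u', hu', rfl⟩
          · rw [er x hx]
            refine (h6 x ?_).trans (by omega)
            obtain ⟨y, rfl⟩ := hx
            exact ⟨u ++ (t ++ (s ++ (v ++ y))), by simp⟩
          · have : ev F (u' ++ iv q :: r) = ev f (u' ++ (s ++ (v ++ r))) * a⁻¹ := by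
              simp only [ev_append, ev_cons, lv_iv, Fq, et _ hu', er _ (List.suffix_refl _)]
              group
            rw [this]
            obtain ⟨y, rfl⟩ := hu'
            have := nmul (h6 (u' ++ (s ++ (v ++ r))) ⟨u ++ y, by simp⟩) (ninv na)
            omega
        · have : ev F (u' ++ iv p :: (t ++ iv q :: r)) = ev f (u' ++ (v ++ r)) * (b⁻¹ * a⁻¹) := by
            simp only [ev_append, ev_cons, lv_iv, Fp, Fq, es _ hu', et _ (List.suffix_refl _),
              er _ (List.suffix_refl _)]
            group
          rw [this]
          obtain ⟨y, rfl⟩ := hu'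
          have := nmul (h6 (u' ++ (v ++ r)) ⟨u ++ (t ++ y), by simp⟩) (nmul (ninv nb) (ninv na))
          omega
      · have : ev F (u' ++ q :: (s ++ iv p :: (t ++ iv q :: r))) =
            ev f (u' ++ r) * (a * b⁻¹ * a⁻¹) := by
          simp only [ev_append, ev_cons, lv_iv, Fp, Fq, evv _ hu', es _ (List.suffix_refl _),
            et _ (List.suffix_refl _), er _ (List.suffix_refl _)]
          group
        rw [this]
        obtain ⟨y, rfl⟩ := hu'
        have := nmul (h6 (u' ++ r) ⟨u ++ (t ++ (s ++ y)), by simp⟩) (nmul (nmul na (ninv nb)) (ninv na))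
        omega
    · have : ev F (u' ++ p :: (v ++ q :: (s ++ iv p :: (t ++ iv q :: r)))) =
          ev f (u' ++ (t ++ (s ++ (v ++ r)))) * (b * a * b⁻¹ * a⁻¹) := by
        simp only [ev_append, ev_cons, lv_iv, Fp, Fq, eu _ hu', evv _ (List.suffix_refl _),
          es _ (List.suffix_refl _), et _ (List.suffix_refl _), er _ (List.suffix_refl _)]
        group
      rw [this]
      obtain ⟨y, rfl⟩ := hu'
      have := nmul (h6 (u' ++ (t ++ (s ++ (v ++ r)))) ⟨y, by simp⟩)
        (nmul (nmul (nmul nb na) (ninv nb)) (ninv na))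
      omega

lemma Short.mono {V : α → Prop} {L D D' k : ℕ} {Q : List (α × Bool)} {W : List (List (α × Bool))}
    (h : Short V L D k Q W) (hD : D ≤ D') : Short V L D' k Q W := by
  obtain ⟨f, hf, l, C, h1, h2, h3, h4, h5, h6⟩ := h
  exact ⟨f, hf, l, C, h1, h2, h3, h4, h5, fun s hs => (h6 s hs).trans hD⟩

/-- increment -/
def Dl (N : ℕ) : ℕ := 4 * (3 * N + 2 * (N * (3 * N + 1))) + (2 * (3 * N + N * (3 * N + 1)) + N)

lemma main (V : α → Prop) (N : ℕ) : ∀ (n : ℕ) (Q : List (α × Bool)) (W : List (List (α × Bool)))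
    (k : ℕ), Q.length = n → Q.length + sz W ≤ N → Bal (fun _ => True) (Q ++ W.flatten) →
    (∀ w ∈ W, ∀ l ∈ w, ¬ V l.1) → HS V k Q W → Short V (3 * N) (N + n * Dl N) k Q W := by
  intro n
  induction n using Nat.strong_induction_on with
  | _ n ih =>
  intro Q W k hn hN hB hW hS
  have hBV : Bal V Q := by
    intro a ha
    have := hB a trivial
    have hc : ∀ b, W.flatten.count (a, b) = 0 := by
      intro b
      rw [List.count_eq_zero]
      intro hmem
      obtain ⟨w, hw, hl⟩ := List.mem_flatten.1 hmem
      exact hW w hw _ hl ha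
    simpa [List.count_append, hc] using this
  rcases chord hBV with h | ⟨u, p, m, z, rfl, hp, h⟩ | ⟨u, p, v, q, s, t, r, rfl, hp, hq⟩
  · obtain ⟨f, hf, l, hl, hT⟩ := hS
    have : ev f Q = ev e Q := ev_congr (fun x hx => hf _ (h x hx))
    rw [this] at hT
    obtain ⟨l', C, a1, a2, a3, a4, a5⟩ := stage3 N W.length W Q k rfl hN hB ⟨l, hl, hT⟩
    refine ⟨FreeGroup.of, fun _ _ => rfl, l', C, a1, a2, a3, a4, a5, fun s hs => ?_⟩
    have := norm_ev_of s
    have := hs.length_le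
    omega
  · have hB1 : Bal (fun _ => True) (p :: iv p :: ((u ++ z) ++ (m :: W).flatten)) := by
      refine hB.perm ?_
      rw [List.perm_iff_count]
      intro a
      simp only [List.count_append, List.count_cons, List.flatten_cons]
      omega
    have hn1 := hB1.notin trivial
    simp only [List.length_append, List.length_cons] at hn hN
    have h1 := ih (u ++ z).length (by simp; omega) (u ++ z) (m :: W) k rfl
      (by simp [sz] at hN ⊢; omega) hB1.tail
      (by intro w hw; rcases List.mem_cons.1 hw with rfl | hw
          · exact h
          · exact hW w hw) (hS.inner h)
    refine (Short.inner (N := N) hp h (fun l hl => hn1 l (by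
      simp only [List.mem_append, List.flatten_cons] at hl ⊢; tauto))
      (by simp [sz] at hN ⊢; omega) h1).mono ?_
    have : ((u ++ z).length + 1) * Dl N ≤ n * Dl N := Nat.mul_le_mul_right _ (by simp; omega)
    have h3 : 2 * (3 * N + N * (3 * N + 1)) + N ≤ Dl N := by unfold Dl; omega
    rw [Nat.add_mul] at this
    omega
  · have hB1 : Bal (fun _ => True)
        (p :: iv p :: (q :: iv q :: ((u ++ (t ++ (s ++ (v ++ r)))) ++ W.flatten))) := by
      refine hB.perm ?_
      rw [List.perm_iff_count]
      intro a
      simp only [List.count_append, List.count_cons]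
      omega
    have hn1 := hB1.notin trivial
    have hB2 := hB1.tail
    have hn2 := hB2.notin trivial
    simp only [List.length_append, List.length_cons] at hn hN
    have h1 := ih (u ++ (t ++ (s ++ (v ++ r)))).length (by simp; omega) _ W (k + 1) rfl
      (by simp; omega) hB2.tail hW hS.handle
    refine (Short.handle (N := N) hp hq (fun l hl => hn1 l (by
      simp only [List.mem_append, List.mem_cons] at hl ⊢; tauto))
      (fun l hl => hn2 l (List.mem_append_left _ hl))
      (by omega) h1).mono ?_
    have : ((u ++ (t ++ (s ++ (v ++ r)))).length + 1) * Dl N ≤ n * Dl N :=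
      Nat.mul_le_mul_right _ (by simp; omega)
    have h3 : 4 * (3 * N + 2 * (N * (3 * N + 1))) ≤ Dl N := by unfold Dl; omega
    rw [Nat.add_mul] at this
    omega

end QEq

namespace QEq
open Heis
variable {α β γ : Type} {G : Type} [Group G]

/-- relabel letters -/
def mp (μ : α → β) (w : List (α × Bool)) : List (β × Bool) := w.map (fun l => (μ l.1, l.2))

/-- formal inverse -/
def rv (w : List (α × Bool)) : List (α × Bool) := (w.map iv).reverse

@[simp] lemma mp_nil (μ : α → β) : mp μ [] = [] := rfl
@[simp] lemma mp_cons (μ : α → β) (l w) : mp μ (l :: w) = (μ l.1, l.2) :: mp μ w := rfl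
@[simp] lemma mp_append (μ : α → β) (u w) : mp μ (u ++ w) = mp μ u ++ mp μ w := by simp [mp]
lemma mp_mp (μ : α → β) (ν : β → γ) (w) : mp ν (mp μ w) = mp (fun a => ν (μ a)) w := by
  simp [mp]
lemma mp_congr {μ ν : α → β} {w : List (α × Bool)} (h : ∀ l ∈ w, μ l.1 = ν l.1) :
    mp μ w = mp ν w := List.map_congr_left (fun l hl => by rw [h l hl])
lemma mem_mp {μ : α → β} {w : List (α × Bool)} {x : β × Bool} :
    x ∈ mp μ w ↔ ∃ l ∈ w, μ l.1 = x.1 ∧ l.2 = x.2 := by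
  rcases x with ⟨a, b⟩
  simp [mp]
lemma mp_rv (μ : α → β) (w) : mp μ (rv w) = rv (mp μ w) := by
  simp [mp, rv, iv, Function.comp_def]
@[simp] lemma rv_nil : rv ([] : List (α × Bool)) = [] := rfl
lemma rv_cons (l : α × Bool) (w) : rv (l :: w) = rv w ++ [iv l] := by simp [rv]
lemma rv_rv (w : List (α × Bool)) : rv (rv w) = w := by
  simp [rv, Function.comp_def]
lemma mem_rv {w : List (α × Bool)} {l : α × Bool} (h : l ∈ rv w) : ∃ x ∈ w, x.1 = l.1 := by
  simp only [rv, List.mem_reverse, List.mem_map] at h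
  obtain ⟨x, hx, rfl⟩ := h
  exact ⟨x, hx, rfl⟩
lemma ev_rv (f : α → G) (w) : ev f (rv w) = (ev f w)⁻¹ := by
  induction w with
  | nil => simp
  | cons l w ih => simp [rv_cons, ih]
lemma ev_mp (f : β → G) (μ : α → β) (w : List (α × Bool)) :
    ev f (mp μ w) = ev (fun a => f (μ a)) w := ev_map f μ w
lemma mp_split {μ : α → β} {w : List (α × Bool)} {u v : List (β × Bool)} (h : mp μ w = u ++ v) :
    ∃ u' v', w = u' ++ v' ∧ mp μ u' = u ∧ mp μ v' = v := by
  obtain ⟨u', v', h1, h2, h3⟩ := List.map_eq_append_iff.1 h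
  exact ⟨u', v', h1, h2, h3⟩

lemma Bal.add [DecidableEq α] {P : α → Prop} {p : α × Bool} {w : List (α × Bool)} (h : Bal P w)
    (hp : ∀ l ∈ w, l.1 ≠ p.1) : Bal P (p :: iv p :: w) := by
  intro a ha
  have := h a ha
  have h0 : ∀ b, w.count (p.1, b) = 0 := fun b => List.count_eq_zero.2 (fun hm => hp _ hm rfl)
  rcases p with ⟨c, b⟩
  by_cases hc : c = a
  · subst hc
    cases b <;> simp [iv, h0]
  · simpa [iv, List.count_cons, hc] using this

/-- merging map -/
def m0 [DecidableEq α] (i j : α) : α → α := fun a => if a = i then j else a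

lemma count_m0 [DecidableEq α] (i j : α) (hij : i ≠ j) (S : List (α × Bool)) (k : α) (c : Bool) :
    (mp (m0 i j) S).count (k, c) = if k = i then 0 else
      if k = j then S.count (j, c) + S.count (i, c) else S.count (k, c) := by
  induction S with
  | nil => simp
  | cons l S ih =>
    rcases l with ⟨a, b⟩
    rw [mp_cons, List.count_cons, ih]
    simp only [List.count_cons, m0]
    by_cases h1 : k = i
    · subst h1
      by_cases h2 : a = k <;> simp [h2, hij.symm]
    · by_cases h2 : k = j
      · subst h2
        by_cases h3 : a = i
        · subst h3
          simp [h1, hij]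
          omega
        · simp [h1, h3]
          omega
      · by_cases h3 : a = i
        · subst h3
          have h4 : ¬ j = k := fun h => h2 h.symm
          have h5 : ¬ a = k := fun h => h1 h.symm
          simp [h1, h2, h4, h5]
        · simp [h1, h2, h3]

lemma Bal.merge1 [DecidableEq α] {P : α → Prop} {i j : α} {b : Bool} {S : List (α × Bool)}
    (hi : P i) (hj : P j) (h : Bal P ((i, b) :: (j, !b) :: S)) : Bal P (mp (m0 i j) S) := by
  by_cases hij : i = j
  · subst hij
    have h1 : Bal P ((i, b) :: iv (i, b) :: S) := h
    have h2 : mp (m0 i i) S = S := by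
      have : mp (m0 i i) S = mp (fun a => a) S := mp_congr (fun l _ => by
        simp only [m0]; split <;> simp_all)
      rw [this]; simp [mp]
    rw [h2]; exact h1.tail
  · intro a ha
    rw [count_m0 i j hij, count_m0 i j hij]
    have hji : ¬ j = i := fun h => hij h.symm
    by_cases h1 : a = i
    · simp [h1]
    · by_cases h2 : a = j
      · subst h2
        have e1 := h i hi
        have e2 := h a ha
        cases b <;> simp [hij, hji] at e1 e2 ⊢ <;> omega
      · have e1 := h a ha
        have h1' : ¬ i = a := fun h => h1 h.symm
        have h2' : ¬ j = a := fun h => h2 h.symm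
        simpa [h1, h2, h1', h2'] using e1

lemma merge [DecidableEq α] {P : α → Prop} (ρ : α → β) (hP : ∀ a b, ρ a = ρ b → P a → P b) :
    ∀ (g1 g2 R : List (α × Bool)), (∀ l ∈ g1, P l.1) → mp ρ g1 = mp ρ g2 →
    Bal P (g1 ++ (rv g2 ++ R)) →
    ∃ μ : α → α, (∀ a, ρ (μ a) = ρ a) ∧ mp μ g1 = mp μ g2 ∧ Bal P (mp μ R) := by
  intro g1
  induction hn : g1.length generalizing g1 with
  | zero =>
    intro g2 R _ h hB
    have h1 := List.length_eq_zero_iff.1 hn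
    subst h1
    have h2 : g2 = [] := by simpa [mp] using h.symm
    subst h2
    refine ⟨fun a => a, fun _ => rfl, rfl, ?_⟩
    have : mp (fun a => a) R = R := by simp [mp]
    rw [this]; simpa using hB
  | succ n ih =>
    intro g2 R h1 h hB
    obtain ⟨⟨i, b⟩, g1, rfl⟩ : ∃ l g, g1 = l :: g := by
      cases g1 with
      | nil => simp at hn
      | cons l g => exact ⟨l, g, rfl⟩
    obtain ⟨⟨j, b'⟩, g2, rfl⟩ : ∃ l g, g2 = l :: g := by
      cases g2 with
      | nil => simp at h
      | cons l g => exact ⟨l, g, rfl⟩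
    simp only [mp_cons, List.cons.injEq, Prod.mk.injEq] at h
    obtain ⟨⟨hij, rfl⟩, h⟩ := h
    have hi : P i := h1 (i, b) (by simp)
    have hj : P j := hP _ _ hij hi
    have hB' : Bal P ((i, b) :: (j, !b) :: (g1 ++ (rv g2 ++ R))) := by
      refine hB.perm ?_
      rw [List.perm_iff_count]
      intro a
      simp only [rv_cons, List.count_append, List.count_cons, iv, List.count_nil]
      omega
    have hB2 := hB'.merge1 hi hj
    simp only [mp_append, mp_rv] at hB2
    have hρ : ∀ a, ρ (m0 i j a) = ρ a := by
      intro a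
      simp only [m0]; split
      · rename_i h; rw [h, hij]
      · rfl
    obtain ⟨μ, a1, a2, a3⟩ := ih (mp (m0 i j) g1) (by simp [mp] at hn ⊢; omega)
      (mp (m0 i j) g2) (mp (m0 i j) R)
      (by
        intro l hl
        obtain ⟨x, hx, hx1, -⟩ := mem_mp.1 hl
        rw [← hx1]
        exact hP _ _ (hρ _).symm (h1 x (by simp [hx])))
      (by
        rw [mp_mp, mp_mp]
        simpa only [hρ] using h) hB2
    refine ⟨fun a => μ (m0 i j a), fun a => by rw [a1, hρ], ?_, by rwa [mp_mp] at a3⟩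
    rw [mp_mp, mp_mp] at a2
    simp only [mp_cons, a2]
    congr 2
    by_cases hh : j = i <;> simp [m0, hh]

variable {X A : Type}

instance instBS {X Y : Type} [DecidableEq X] [DecidableEq Y] : BEq (X ⊕ Y) :=
  instBEqOfDecidableEq

instance instBSL {X Y : Type} [DecidableEq X] [DecidableEq Y] :
    LawfulBEq (X ⊕ Y) :=
  inferInstanceAs (@LawfulBEq (X ⊕ Y) instBEqOfDecidableEq)

lemma base [DecidableEq X] [DecidableEq A] [Nonempty A] (w : List (A × Bool)) (h : FreeGroup.Red w []) :
    ∃ (wh : List ((X ⊕ ℕ) × Bool)) (lam : ℕ → A),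
      mp (Sum.map id lam) wh = mp Sum.inr w ∧ Bal (fun _ => True) wh ∧ ev FreeGroup.of wh = 1 := by
  induction h using Relation.ReflTransGen.head_induction_on with
  | refl => exact ⟨[], fun _ => Classical.arbitrary A, rfl, by intro a; simp, rfl⟩
  | head hs _ ih =>
    obtain ⟨wh, lam, h1, h2, h3⟩ := ih
    cases hs with
    | @not L1 L2 x b =>
    rw [mp_append] at h1
    obtain ⟨u, v, rfl, hu, hv⟩ := mp_split h1
    obtain ⟨i, hi⟩ := Infinite.exists_notMem_finset
      (((u ++ v).map (fun l : (X ⊕ ℕ) × Bool => l.1)).toFinset.preimage (Sum.inr : ℕ → X ⊕ ℕ)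
        Sum.inr_injective.injOn)
    have hi' : ∀ l ∈ u ++ v, l.1 ≠ Sum.inr i := by
      intro l hl he
      apply hi
      rw [Finset.mem_preimage, List.mem_toFinset, List.mem_map]
      exact ⟨l, hl, he⟩
    have hc : ∀ l ∈ u ++ v, (Sum.map id (Function.update lam i x) l.1 : X ⊕ A) = Sum.map id lam l.1 := by
      intro l hl
      have := hi' l hl
      rcases hl1 : l.1 with y | j
      · rfl
      · rw [hl1] at this
        have : j ≠ i := fun h => this (by rw [h])
        simp [this]
    refine ⟨u ++ (Sum.inr i, b) :: iv (Sum.inr i, b) :: v, Function.update lam i x, ?_, ?_, ?_⟩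
    · simp only [mp_append, mp_cons, iv]
      rw [mp_congr (fun l hl => hc l (List.mem_append_left _ hl)),
        mp_congr (fun l hl => hc l (List.mem_append_right _ hl)), hu, hv]
      simp
    · refine (Bal.add (p := (Sum.inr i, b)) h2 hi').perm ?_
      rw [List.perm_iff_count]
      intro a
      simp only [List.count_append, List.count_cons]
      omega
    · rw [← h3]; simp

lemma count_inl [DecidableEq X] [DecidableEq A] (lam : ℕ → A) (w : List ((X ⊕ ℕ) × Bool)) (x : X) (b : Bool) :
    (mp (Sum.map id lam) w).count (Sum.inl x, b) = w.count (Sum.inl x, b) := by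
  induction w with
  | nil => rfl
  | cons l w ih =>
    rcases l with ⟨y | i, c⟩ <;> simp [List.count_cons, ih]

lemma count_inr0 [DecidableEq X] [DecidableEq A] (w : List (A × Bool)) (x : X) (b : Bool) :
    (mp (Sum.inr : A → X ⊕ A) w).count (Sum.inl x, b) = 0 := by
  rw [List.count_eq_zero]
  intro h
  obtain ⟨l, -, h, -⟩ := mem_mp.1 h
  simp at h

lemma label [DecidableEq X] [DecidableEq A] [Nonempty A] : ∀ (n : ℕ) (Q : List ((X ⊕ A) × Bool)) (f : X ⊕ A → FreeGroup A),
    (∀ a, f (Sum.inr a) = FreeGroup.of a) →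
    Q.countP (fun l => l.1.isLeft) = n → Bal (fun a => a.isLeft = true) Q → ev f Q = 1 →
    ∃ (Qh : List ((X ⊕ ℕ) × Bool)) (lam : ℕ → A) (F : X ⊕ ℕ → FreeGroup (X ⊕ ℕ)),
      (∀ i, F (Sum.inr i) = FreeGroup.of (Sum.inr i)) ∧
      mp (Sum.map id lam) Qh = Q ∧ Bal (fun a => a.isRight = true) Qh ∧ ev F Qh = 1 := by
  intro n
  induction n using Nat.strong_induction_on with
  | _ n ih =>
  intro Q f hf hn hB h1
  by_cases hX : ∃ l ∈ Q, l.1.isLeft = true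
  · obtain ⟨l, hl, hlX⟩ := hX
    obtain ⟨u, p, v, z, rfl, hpl⟩ := hB.split hl hlX
    rw [← hpl] at hlX
    set g : List (A × Bool) := (lv f p).toWord with hg
    set Gw : List ((X ⊕ A) × Bool) := mp Sum.inr g with hGw
    have hfG : ev f Gw = lv f p := by
      rw [hGw, ev_mp]
      have : (fun a => f (Sum.inr a)) = FreeGroup.of := funext hf
      rw [this, ev_of, hg, FreeGroup.mk_toWord]
    have hBp : Bal (fun a : X ⊕ A => a.isLeft = true) (p :: iv p :: (u ++ (v ++ z))) := by
      refine hB.perm ?_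
      rw [List.perm_iff_count]
      intro a
      simp only [List.count_append, List.count_cons]
      omega
    have hnot := hBp.notin hlX
    have hBt := hBp.tail
    have hG0 : ∀ w : List (A × Bool), (mp (Sum.inr : A → X ⊕ A) w).countP (fun l => l.1.isLeft) = 0 := by
      intro w
      rw [List.countP_eq_zero]
      intro l hl
      obtain ⟨y, -, h, -⟩ := mem_mp.1 hl
      simp [← h]
    have hrv : rv (mp Sum.inr g : List ((X ⊕ A) × Bool)) = mp Sum.inr (rv g) := (mp_rv _ _).symm
    obtain ⟨Qh, lam, F, hF, hm, hBR, hev⟩ := ih _ (by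
        rw [← hn]
        simp only [List.countP_append, List.countP_cons, hrv, hGw, hG0]
        simp only [hlX, iv_fst]
        simp) (u ++ (Gw ++ (v ++ (rv Gw ++ z)))) f hf rfl
      (by
        intro a ha
        rcases a with x | a
        · have := hBt _ ha
          simp only [List.count_append, hrv, hGw, count_inr0] at this ⊢
          omega
        · simp at ha)
      (by
        rw [← h1]
        simp only [ev_append, ev_cons, ev_rv, hfG, lv_iv])
    obtain ⟨uh, Q1, rfl, hu, hm⟩ := mp_split hm
    obtain ⟨g1, Q1, rfl, hg1, hm⟩ := mp_split hm
    obtain ⟨vh, Q1, rfl, hv, hm⟩ := mp_split hm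
    obtain ⟨g2', zh, rfl, hg2, hz⟩ := mp_split hm
    obtain ⟨g2, rfl⟩ : ∃ g2, g2' = rv g2 := ⟨rv g2', (rv_rv _).symm⟩
    have hg2' : mp (Sum.map id lam) g2 = Gw := by
      have := congrArg rv hg2
      rwa [mp_rv, rv_rv, rv_rv] at this
    obtain ⟨μ, a1, a2, a3⟩ := merge (P := fun a : X ⊕ ℕ => a.isRight = true) (Sum.map id lam : X ⊕ ℕ → X ⊕ A)
      (by
        intro a b hab ha
        rcases a with a | a <;> rcases b with b | b <;> simp_all)
      g1 g2 (uh ++ (vh ++ zh))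
      (by
        intro l hl
        have : ((Sum.map id lam l.1 : X ⊕ A), l.2) ∈ Gw := by
          rw [← hg1, mem_mp]; exact ⟨l, hl, rfl, rfl⟩
        rw [hGw, mem_mp] at this
        obtain ⟨y, -, h, -⟩ := this
        rcases hl1 : l.1 with x | i
        · rw [hl1] at h; simp at h
        · rfl)
      (hg1.trans hg2'.symm)
      (by
        refine hBR.perm ?_
        rw [List.perm_iff_count]
        intro a
        simp only [List.count_append]
        omega)
    have hμl : ∀ x, μ (Sum.inl x) = Sum.inl x := by
      intro x
      have := a1 (Sum.inl x)
      rcases h : μ (Sum.inl x) with y | y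
      · rw [h] at this; simpa using this
      · rw [h] at this; simp at this
    have hμr : ∀ i, ∃ j, μ (Sum.inr i) = Sum.inr j := by
      intro i
      have := a1 (Sum.inr i)
      rcases h : μ (Sum.inr i) with y | y
      · rw [h] at this; simp at this
      · exact ⟨y, rfl⟩
    obtain ⟨x, hx⟩ : ∃ x, p.1 = Sum.inl x := by
      rcases h : p.1 with x | y
      · exact ⟨x, rfl⟩
      · rw [h] at hlX; simp at hlX
    set ph : (X ⊕ ℕ) × Bool := (Sum.inl x, p.2) with hph
    set F1 : X ⊕ ℕ → FreeGroup (X ⊕ ℕ) := fun a =>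
      if a.isLeft then FreeGroup.map μ (F a) else FreeGroup.of a with hF1
    have hF1ev : ∀ w, ev F1 (mp μ w) = FreeGroup.map μ (ev F w) := by
      intro w
      rw [ev_mp, map_ev]
      congr 1
      funext a
      rcases a with a | i
      · simp [hF1, hμl]
      · obtain ⟨j, hj⟩ := hμr i
        simp [hF1, hj, hF]
    have hne : ∀ w, (∀ l ∈ mp (Sum.map id lam) w, l.1 ≠ p.1) → ∀ l ∈ mp μ w, l.1 ≠ ph.1 := by
      intro w hw l hl he
      obtain ⟨y, hy, hy1, hy2⟩ := mem_mp.1 hl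
      refine hw (Sum.map id lam y.1, y.2) (mem_mp.2 ⟨y, hy, rfl, rfl⟩) ?_
      simp only
      rw [hx, ← a1, hy1, he]
      rfl
    have hmm : ∀ w, mp (Sum.map id lam) (mp μ w) = mp (Sum.map id lam : X ⊕ ℕ → X ⊕ A) w := by
      intro w; rw [mp_mp]; simp only [a1]
    have hpp : ∀ b : Bool, ((Sum.map id lam (Sum.inl x) : X ⊕ A), b) = (p.1, b) := by
      intro b; rw [hx]; rfl
    refine ⟨mp μ uh ++ ph :: (mp μ vh ++ iv ph :: mp μ zh), lam, upd F1 ph (ev F1 (mp μ g1)), ?_, ?_, ?_, ?_⟩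
    · intro i
      rw [upd_ne _ _ _ (by simp [hph])]
      simp [hF1]
    · simp only [mp_append, mp_cons, hmm, hu, hv, hz, hph, iv, hpp]
    · intro a ha
      have := a3 a ha
      rcases a with y | i
      · simp at ha
      · simp only [mp_append, List.count_append] at this
        simp only [hph, iv, List.count_append, List.count_cons]
        simpa [add_assoc] using this
    · simp only [ev_append, ev_cons, lv_iv, lv_upd]
      rw [ev_upd _ _ _ (hne uh (by rw [hu]; intro l hl; exact hnot l (by simp [hl]))),
        ev_upd _ _ _ (hne vh (by rw [hv]; intro l hl; exact hnot l (by simp [hl]))),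
        ev_upd _ _ _ (hne zh (by rw [hz]; intro l hl; exact hnot l (by simp [hl])))]
      have h5 := congrArg (FreeGroup.map μ) hev
      rw [← hF1ev, map_one] at h5
      rw [← h5]
      simp only [mp_append, ev_append, mp_rv, ev_rv, ← a2]
  · push Not at hX
    obtain ⟨w, rfl⟩ : ∃ w : List (A × Bool), mp Sum.inr w = Q := by
      clear hn hB h1
      induction Q with
      | nil => exact ⟨[], rfl⟩
      | cons l Q ih2 =>
        obtain ⟨w, rfl⟩ := ih2 (fun l hl => hX l (by simp [hl]))
        have := hX l (by simp)
        rcases l with ⟨x | a, b⟩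
        · simp at this
        · exact ⟨(a, b) :: w, rfl⟩
    rw [ev_mp, (funext hf : (fun a => f (Sum.inr a)) = FreeGroup.of), ev_of] at h1
    have hred : FreeGroup.Red w [] := by
      rw [← FreeGroup.toWord_eq_nil_iff, FreeGroup.toWord_mk] at h1
      rw [← h1]; exact FreeGroup.reduce.red
    obtain ⟨wh, lam, b1, b2, b3⟩ := base (X := X) w hred
    exact ⟨wh, lam, FreeGroup.of, fun _ => rfl, b1, fun a _ => b2 a trivial, b3⟩

end QEq

namespace QEq
open Heis

lemma norm_ev_le {α β : Type} [DecidableEq β] (h : α → FreeGroup β) (hh : ∀ a, (h a).norm ≤ 1)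
    (w : List (α × Bool)) : (ev h w).norm ≤ w.length := by
  induction w with
  | nil => simp
  | cons l w ih =>
    rw [ev_cons, List.length_cons, add_comm]
    refine nmul ?_ ih
    unfold lv; split
    · exact hh _
    · exact ninv (hh _)

lemma final {X A : Type} [DecidableEq X] [DecidableEq A] [Nonempty A] (w : List ((X ⊕ A) × Bool))
    (hc : ∀ x b, w.count (Sum.inl x, b) = 1) (f : X ⊕ A → FreeGroup A)
    (hf : ∀ a, f (Sum.inr a) = FreeGroup.of a) (h1 : ev f w = 1) :
    ∃ g : X ⊕ A → FreeGroup A, (∀ a, g (Sum.inr a) = FreeGroup.of a) ∧ ev g w = 1 ∧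
      ∀ x, (g (Sum.inl x)).norm ≤ 120 * w.length ^ 4 := by
  obtain ⟨Qh, lam, F, hF, hm, hB, hev⟩ := label _ w f hf rfl (by
    intro a ha
    rcases a with x | a
    · have e1 := hc x true
      have e2 := hc x false
      omega
    · simp at ha) h1
  have hlen : Qh.length = w.length := by rw [← hm]; simp [mp]
  have hcQ : ∀ x b, Qh.count (Sum.inl x, b) = 1 := by
    intro x b
    rw [← count_inl lam, hm, hc]
  have hBT : Bal (fun _ => True) Qh := by
    intro a _
    rcases a with x | i
    · have e1 := hcQ x true
      have e2 := hcQ x false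
      omega
    · exact hB _ rfl
  obtain ⟨fh, hfh, l, C, b1, -, b2, -, b3, b4⟩ := main (fun a : X ⊕ ℕ => a.isLeft = true) Qh.length
    Qh.length Qh [] 0 rfl (by simp [sz]) (by simpa using hBT) (by simp)
    ⟨fun a => FreeGroup.lift e (F a), by
      intro c hc
      rcases c with x | i
      · simp at hc
      · simp [hF], [], by simp, by
      rw [← map_ev, hev]
      refine ⟨by simp, [], rfl, ?_⟩
      funext i j
      simp⟩
  have hl : l = [] := by simpa using b1
  have hC : C = [] := by simpa using b2
  subst hl hC
  simp only [pr_nil, List.map_nil, List.prod_nil, mul_one] at b3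
  set D := Qh.length + Qh.length * Dl Qh.length with hD
  let ψ : FreeGroup (X ⊕ ℕ) →* FreeGroup A :=
    FreeGroup.lift (Sum.elim (fun _ => 1) (fun i => FreeGroup.of (lam i)))
  have hψ : ∀ g, (ψ g).norm ≤ g.norm := by
    intro g
    have : ψ g = ev (Sum.elim (fun _ => 1) (fun i => FreeGroup.of (lam i))) g.toWord := by
      conv_lhs => rw [← FreeGroup.mk_toWord (x := g), ← ev_of, map_ev]
      simp [ψ]
    rw [this]
    refine norm_ev_le _ ?_ _
    intro a
    rcases a with a | a <;> simp
  refine ⟨Sum.elim (fun x => ψ (fh (Sum.inl x))) FreeGroup.of, fun _ => rfl, ?_, ?_⟩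
  · rw [← hm, ev_mp]
    have := congrArg ψ b3
    rw [map_ev, map_one] at this
    rw [← this]
    congr 1
    funext a
    rcases a with x | i
    · rfl
    · simp [hfh, ψ]
  · intro x
    refine (hψ _).trans ?_
    have hmem : (Sum.inl x, true) ∈ Qh := by
      rw [← List.count_pos_iff, hcQ]; exact one_pos
    obtain ⟨u, v, huv⟩ := List.append_of_mem hmem
    have e1 := b4 ((Sum.inl x, true) :: v) ⟨u, huv.symm⟩
    have e2 := b4 v ⟨u ++ [(Sum.inl x, true)], by rw [huv]; simp⟩
    have e3 : fh (Sum.inl x) = ev fh ((Sum.inl x, true) :: v) * (ev fh v)⁻¹ := by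
      simp [lv]
    rw [e3]
    refine (nmul e1 (ninv e2)).trans ?_
    have hpos : 1 ≤ Qh.length := by rw [huv]; simp; omega
    rw [← hlen, hD]
    generalize Qh.length = n at hpos
    have q1 : n ≤ n ^ 4 := Nat.le_self_pow (by norm_num) n
    have q2 : n ^ 2 ≤ n ^ 4 := Nat.pow_le_pow_right hpos (by norm_num)
    have q3 : n ^ 3 ≤ n ^ 4 := Nat.pow_le_pow_right hpos (by norm_num)
    have : n + n * Dl n = n + 29 * n ^ 2 + 30 * n ^ 3 := by unfold Dl; ring
    omega

end QEq


namespace Stmt7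

/-- In a free group F of finite rank ≥ 2, every solvable orientable quadratic equation
Q = 1 has a solution φ with |φ(x)| ≤ N·|Q|⁴ for every variable x, where N depends only
on F and |Q| is the length of Q as a reduced word in F(X ∪ A). -/
theorem orientable_quadratic_minimal_solution_bound_free (r : ℕ) (hr : 2 ≤ r) :
    ∃ N : ℕ, ∀ (nv : ℕ) (Q : FreeGroup (Fin nv ⊕ Fin r)),
      (∀ x : Fin nv, occ Q x = 2) →
      (∀ x : Fin nv, occS Q x true = 1 ∧ occS Q x false = 1) →
      (∃ φ, IsSol Q φ) →
      ∃ φ, IsSol Q φ ∧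
        ∀ x : Fin nv, len (φ (FreeGroup.of (Sum.inl x))) ≤ N * Q.toWord.length ^ 4 := by
  refine ⟨120, fun nv Q _ hS ⟨φ, hφ, hφQ⟩ => ?_⟩
  have : Nonempty (Fin r) := ⟨⟨0, by omega⟩⟩
  obtain ⟨g, hg, hgQ, hgb⟩ := QEq.final Q.toWord
    (by
      intro x b
      have : occS Q x b = 1 := by cases b <;> simp [hS x]
      rw [← this, occS, List.count, List.countP_eq_length_filter]
      congr 2)
    (fun a => φ (FreeGroup.of a)) hφ
    (by rw [← QEq.map_ev, QEq.ev_of, FreeGroup.mk_toWord, hφQ])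
  refine ⟨FreeGroup.lift g, ⟨fun a => by simp [hg], ?_⟩, fun x => ?_⟩
  · conv_lhs => rw [← FreeGroup.mk_toWord (x := Q), ← QEq.ev_of, QEq.map_ev]
    simpa using hgQ
  · have := hgb x
    rw [FreeGroup.lift_apply_of]
    exact this

end Stmt7
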